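/- For every excursion f and all s, t, u ∈ [0, τ(f)], there exists a point r ∈ [0, τ(f)] (a branch point of s, t, u) such that d_f(s,r) = (d_f(s,t) + d_f(s,u) − d_f(t,u))/2, d_f(t,r) = (d_f(s,t) + d_f(t,u) − d_f(s,u))/2, and d_f(u,r) = (d_f(s,u) + d_f(t,u) − d_f(s,t))/2. Moreover, any r' ∈ [0, τ(f)] satisfying the same three equations has d_f(r, r') = 0. -/

import Mathlib

/-- The infimum of `f` over the interval between `s` and `t`. -/
noncomputable def excursionInf (f : ℝ → ℝ) (s t : ℝ) : ℝ :=
  sInf (f '' Set.Icc (min s t) (max s t))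

/-- The excursion pseudo-distance `d_f(s,t) = f(s) + f(t) - 2 m_f(s,t)`. -/
noncomputable def excursionDist (f : ℝ → ℝ) (s t : ℝ) : ℝ :=
  f s + f t - 2 * excursionInf f s t

section

variable {f : ℝ → ℝ} {S : Set ℝ} {a b c r r' s t u x : ℝ}

theorem excursionInf_comm (f : ℝ → ℝ) (s t : ℝ) : excursionInf f s t = excursionInf f t s := by
  simp only [excursionInf, min_comm, max_comm]

theorem excursionDist_comm (f : ℝ → ℝ) (s t : ℝ) : excursionDist f s t = excursionDist f t s := by
  simp only [excursionDist, excursionInf_comm f s t, add_comm]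

theorem exists_eq_excursionInf (hf : ContinuousOn f S) (hS : S.OrdConnected) (ha : a ∈ S)
    (hb : b ∈ S) : ∃ x ∈ Set.uIcc a b, f x = excursionInf f a b :=
  (isCompact_uIcc.image_of_continuousOn (hf.mono (hS.uIcc_subset ha hb))).sInf_mem
    (Set.nonempty_uIcc.image f)

theorem excursionInf_le (hf : ContinuousOn f S) (hS : S.OrdConnected) (ha : a ∈ S)
    (hb : b ∈ S) (hx : x ∈ Set.uIcc a b) : excursionInf f a b ≤ f x :=
  csInf_le (isCompact_uIcc.image_of_continuousOn (hf.mono (hS.uIcc_subset ha hb))).bddBelow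
    (Set.mem_image_of_mem f hx)

theorem excursionInf_le_left (hf : ContinuousOn f S) (hS : S.OrdConnected) (ha : a ∈ S)
    (hb : b ∈ S) : excursionInf f a b ≤ f a :=
  excursionInf_le hf hS ha hb Set.left_mem_uIcc

theorem excursionInf_le_right (hf : ContinuousOn f S) (hS : S.OrdConnected) (ha : a ∈ S)
    (hb : b ∈ S) : excursionInf f a b ≤ f b :=
  excursionInf_le hf hS ha hb Set.right_mem_uIcc

/-- The infimum satisfies a reversed ultrametric inequality. -/
theorem min_excursionInf_le (hf : ContinuousOn f S) (hS : S.OrdConnected) (ha : a ∈ S)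
    (hb : b ∈ S) (hc : c ∈ S) :
    min (excursionInf f a b) (excursionInf f b c) ≤ excursionInf f a c := by
  obtain ⟨x, hx, hfx⟩ := exists_eq_excursionInf hf hS ha hc
  rw [← hfx]
  rcases Set.uIcc_subset_uIcc_union_uIcc (b := b) hx with h | h
  · exact min_le_of_left_le (excursionInf_le hf hS ha hb h)
  · exact min_le_of_right_le (excursionInf_le hf hS hb hc h)

/-- Among the three pairwise infima of three points, the smallest value is taken twice. -/
theorem excursionInf_isosceles (hf : ContinuousOn f S) (hS : S.OrdConnected) (hs : s ∈ S)
    (ht : t ∈ S) (hu : u ∈ S) :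
    (excursionInf f s t = excursionInf f s u ∧ excursionInf f s t ≤ excursionInf f t u) ∨
    (excursionInf f s t = excursionInf f t u ∧ excursionInf f s t ≤ excursionInf f s u) ∨
    (excursionInf f s u = excursionInf f t u ∧ excursionInf f s u ≤ excursionInf f s t) := by
  have h₁ := min_excursionInf_le hf hS hs ht hu
  have h₂ := min_excursionInf_le hf hS hs hu ht
  have h₃ := min_excursionInf_le hf hS ht hs hu
  rw [excursionInf_comm f u t] at h₂
  rw [excursionInf_comm f t s] at h₃
  grind

/-- `r` realises the three Gromov products of `s`, `t`, `u`. -/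
def IsExcursionBranchPoint (f : ℝ → ℝ) (s t u r : ℝ) : Prop :=
  excursionDist f s r =
      (excursionDist f s t + excursionDist f s u - excursionDist f t u) / 2 ∧
    excursionDist f t r =
      (excursionDist f s t + excursionDist f t u - excursionDist f s u) / 2 ∧
    excursionDist f u r =
      (excursionDist f s u + excursionDist f t u - excursionDist f s t) / 2

/-- If the branch towards `s` splits off lowest, a minimiser of `f` between `t` and `u` is a
branch point. -/
theorem exists_isExcursionBranchPoint_of_le (hf : ContinuousOn f S) (hS : S.OrdConnected)
    (hs : s ∈ S) (ht : t ∈ S) (hu : u ∈ S) (h : excursionInf f s t = excursionInf f s u)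
    (hle : excursionInf f s t ≤ excursionInf f t u) :
    ∃ r ∈ S, IsExcursionBranchPoint f s t u r := by
  obtain ⟨r, hr, hfr⟩ := exists_eq_excursionInf hf hS ht hu
  have hrS : r ∈ S := hS.uIcc_subset ht hu hr
  have key : ∀ {v}, v ∈ S → Set.uIcc v r ⊆ Set.uIcc t u → excursionInf f v r = f r := by
    intro v hv hsub
    refine le_antisymm (excursionInf_le_right hf hS hv hrS) ?_
    obtain ⟨y, hy, hfy⟩ := exists_eq_excursionInf hf hS hv hrS
    rw [← hfy, hfr]
    exact excursionInf_le hf hS ht hu (hsub hy)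
  have htr := key ht (Set.uIcc_subset_uIcc_left hr)
  have hur := key hu (Set.uIcc_subset_uIcc Set.right_mem_uIcc hr)
  have hsr : excursionInf f s r = excursionInf f s t := by
    have h₁ := min_excursionInf_le hf hS hs ht hrS
    have h₂ := min_excursionInf_le hf hS hs hrS ht
    have h₃ := excursionInf_le_right hf hS hs hrS
    rw [excursionInf_comm f r t] at h₂
    grind
  refine ⟨r, hrS, ?_, ?_, ?_⟩ <;> simp only [excursionDist] <;> linarith

theorem exists_isExcursionBranchPoint (hf : ContinuousOn f S) (hS : S.OrdConnected)
    (hs : s ∈ S) (ht : t ∈ S) (hu : u ∈ S) : ∃ r ∈ S, IsExcursionBranchPoint f s t u r := by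
  rcases excursionInf_isosceles hf hS hs ht hu with ⟨h, hle⟩ | ⟨h, hle⟩ | ⟨h, hle⟩
  · exact exists_isExcursionBranchPoint_of_le hf hS hs ht hu h hle
  · rw [excursionInf_comm f s t] at h hle
    obtain ⟨r, hr, h₁, h₂, h₃⟩ := exists_isExcursionBranchPoint_of_le hf hS ht hs hu h hle
    rw [excursionDist_comm f t s] at h₁ h₂ h₃
    exact ⟨r, hr, by linarith, by linarith, by linarith⟩
  · rw [excursionInf_comm f s u] at h hle
    rw [excursionInf_comm f t u] at h
    obtain ⟨r, hr, h₁, h₂, h₃⟩ := exists_isExcursionBranchPoint_of_le hf hS hu hs ht h hle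
    rw [excursionDist_comm f u s, excursionDist_comm f u t] at h₁ h₂ h₃
    exact ⟨r, hr, by linarith, by linarith, by linarith⟩

/-- A point on the geodesic between `s` and `t` is an ancestor of `s` or of `t`. -/
theorem excursionInf_eq_or_of_excursionDist_add (hf : ContinuousOn f S) (hS : S.OrdConnected)
    (hs : s ∈ S) (ht : t ∈ S) (hr : r ∈ S)
    (h : excursionDist f s r + excursionDist f t r = excursionDist f s t) :
    excursionInf f s r = f r ∨ excursionInf f t r = f r := by
  have h₁ := min_excursionInf_le hf hS hs hr ht
  have h₂ := excursionInf_le_right hf hS hs hr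
  have h₃ := excursionInf_le_right hf hS ht hr
  rw [excursionInf_comm f r t] at h₁
  simp only [excursionDist] at h
  grind

/-- Two ancestors of `x` at the same distance from `x` are at distance zero. -/
theorem excursionDist_eq_zero_of_excursionInf_eq (hf : ContinuousOn f S) (hS : S.OrdConnected)
    (hx : x ∈ S) (hr : r ∈ S) (hr' : r' ∈ S) (h : excursionInf f x r = f r)
    (h' : excursionInf f x r' = f r') (hd : excursionDist f x r = excursionDist f x r') :
    excursionDist f r r' = 0 := by
  have h₁ := min_excursionInf_le hf hS hr hx hr'
  have h₂ := excursionInf_le_left hf hS hr hr'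
  rw [excursionInf_comm f r x, h, h'] at h₁
  simp only [excursionDist, h, h'] at hd ⊢
  have hrr : f r = f r' := by linarith
  rw [← hrr, min_self] at h₁
  linarith

theorem IsExcursionBranchPoint.excursionDist_eq_zero (hf : ContinuousOn f S)
    (hS : S.OrdConnected) (hs : s ∈ S) (ht : t ∈ S) (hu : u ∈ S) (hr : r ∈ S) (hr' : r' ∈ S)
    (h : IsExcursionBranchPoint f s t u r) (h' : IsExcursionBranchPoint f s t u r') :
    excursionDist f r r' = 0 := by
  have two_of_three : ∀ {q}, q ∈ S → IsExcursionBranchPoint f s t u q →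
      (excursionInf f s q = f q ∨ excursionInf f t q = f q) ∧
      (excursionInf f s q = f q ∨ excursionInf f u q = f q) ∧
      (excursionInf f t q = f q ∨ excursionInf f u q = f q) := by
    rintro q hq ⟨h₁, h₂, h₃⟩
    exact ⟨excursionInf_eq_or_of_excursionDist_add hf hS hs ht hq (by linarith),
      excursionInf_eq_or_of_excursionDist_add hf hS hs hu hq (by linarith),
      excursionInf_eq_or_of_excursionDist_add hf hS ht hu hq (by linarith)⟩
  have common : (excursionInf f s r = f r ∧ excursionInf f s r' = f r') ∨
      (excursionInf f t r = f r ∧ excursionInf f t r' = f r') ∨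
      (excursionInf f u r = f r ∧ excursionInf f u r' = f r') := by
    have := two_of_three hr h
    have := two_of_three hr' h'
    tauto
  rcases common with ⟨e, e'⟩ | ⟨e, e'⟩ | ⟨e, e'⟩
  · exact excursionDist_eq_zero_of_excursionInf_eq hf hS hs hr hr' e e' (h.1.trans h'.1.symm)
  · exact excursionDist_eq_zero_of_excursionInf_eq hf hS ht hr hr' e e'
      (h.2.1.trans h'.2.1.symm)
  · exact excursionDist_eq_zero_of_excursionInf_eq hf hS hu hr hr' e e'
      (h.2.2.trans h'.2.2.symm)

end

/-- For every excursion `f` and `s, t, u ∈ [0, τ(f)]` there is a branch point `r`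
realising the Gromov products, and it is unique up to `d_f`-distance zero. -/
theorem excursion_branch_point
    (f : ℝ → ℝ) (τ : ℝ) (hτ : 0 < τ)
    (hf_cont : ContinuousOn f (Set.Ici 0))
    (hf_nonneg : ∀ t ∈ Set.Ici (0 : ℝ), 0 ≤ f t)
    (hf_pos : ∀ t ∈ Set.Ici (0 : ℝ), (0 < f t ↔ t ∈ Set.Ioo 0 τ)) :
    ∀ s ∈ Set.Icc (0 : ℝ) τ, ∀ t ∈ Set.Icc (0 : ℝ) τ, ∀ u ∈ Set.Icc (0 : ℝ) τ,
      ∃ r ∈ Set.Icc (0 : ℝ) τ,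
        (excursionDist f s r =
            (excursionDist f s t + excursionDist f s u - excursionDist f t u) / 2 ∧
         excursionDist f t r =
            (excursionDist f s t + excursionDist f t u - excursionDist f s u) / 2 ∧
         excursionDist f u r =
            (excursionDist f s u + excursionDist f t u - excursionDist f s t) / 2) ∧
        ∀ r' ∈ Set.Icc (0 : ℝ) τ,
          (excursionDist f s r' =
              (excursionDist f s t + excursionDist f s u - excursionDist f t u) / 2 ∧
           excursionDist f t r' =
              (excursionDist f s t + excursionDist f t u - excursionDist f s u) / 2 ∧
           excursionDist f u r' =
              (excursionDist f s u + excursionDist f t u - excursionDist f s t) / 2) →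
          excursionDist f r r' = 0 := by
  intro s hs t ht u hu
  have hf : ContinuousOn f (Set.Icc 0 τ) := hf_cont.mono Set.Icc_subset_Ici_self
  obtain ⟨r, hr, hbr⟩ := exists_isExcursionBranchPoint hf Set.ordConnected_Icc hs ht hu
  exact ⟨r, hr, hbr, fun r' hr' hbr' =>
    hbr.excursionDist_eq_zero hf Set.ordConnected_Icc hs ht hu hr hr' hbr'⟩
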